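/- For all integers n ≥ 0 and h ≥ 0, the number of full binary trees with n internal vertices and refined Horton–Strahler number h equals the number of Dyck paths of length 2n with height h. -/

import Mathlib

/-- Words over the alphabet {1,2}, encoded as lists of booleans (`false` = 1, `true` = 2). -/
abbrev Word := List Bool

/-- Longest common prefix of two words (`u ∧ v`). -/
def lcp : Word → Word → Word
  | a :: as, b :: bs => if a = b then a :: lcp as bs else []
  | _, _ => []

/-- The lexicographic (strict) order on words; a strict prefix is smaller. -/
def wlex (u v : Word) : Prop := List.Lex (· < ·) u v

/-- A binary tree: a finite, prefix-closed set of words containing the empty word. -/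
def IsBinaryTree (t : Set Word) : Prop :=
  t.Finite ∧ ([] : Word) ∈ t ∧ ∀ u ∈ t, ∀ v : Word, v <+: u → v ∈ t

/-- Fullness: each vertex has either zero or two children. -/
def IsFull (t : Set Word) : Prop :=
  ∀ u ∈ t, (u ++ [false] ∈ t ↔ u ++ [true] ∈ t)

def IsFullBinaryTree (t : Set Word) : Prop := IsBinaryTree t ∧ IsFull t

/-- `φ` is an embedding of `t` into `t'`: injective on `t`, strictly increasing for the
lexicographic order, and preserving longest common prefixes. -/
def IsEmbedding (t t' : Set Word) (φ : Word → Word) : Prop :=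
  (∀ u ∈ t, φ u ∈ t') ∧
  (∀ u ∈ t, ∀ v ∈ t, u ≠ v → φ u ≠ φ v) ∧
  (∀ u ∈ t, ∀ v ∈ t, wlex u v → wlex (φ u) (φ v)) ∧
  (∀ u ∈ t, ∀ v ∈ t, φ (lcp u v) = lcp (φ u) (φ v))

/-- `t` can be embedded in `t'`. -/
def Embeds (t t' : Set Word) : Prop := ∃ φ, IsEmbedding t t' φ

/-- `graft b t = b · t`, the copy of `t` rooted at the child `b` of the root. -/
def graft (b : Bool) (t : Set Word) : Set Word := (fun w => b :: w) '' t

/-- The interpolating trees: τ₀ = {∅}, τ₁ = {∅,1,2},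
τ_{2m} = {∅} ∪ 1·τ_m ∪ 2·τ_{m-1}, τ_{2m+1} = {∅} ∪ 1·τ_m ∪ 2·τ_m (for m ≥ 1). -/
def tau : ℕ → Set Word
  | 0 => {[]}
  | 1 => {[], [false], [true]}
  | n + 2 => {[]} ∪ graft false (tau ((n + 2) / 2)) ∪ graft true (tau ((n + 1) / 2))
termination_by n => n
decreasing_by all_goals omega

/-- The subtree of `t` rooted at `u`: θ_u t = {v : uv ∈ t}. -/
def subtreeAt (u : Word) (t : Set Word) : Set Word := {v | u ++ v ∈ t}

/-- The refined Horton–Strahler number S(t) = max {r : τ_r embeds in t}. -/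
noncomputable def RHS (t : Set Word) : ℕ := sSup {r | Embeds (tau r) t}

/-- S_u(t) = S(θ_u t). -/
noncomputable def Sv (u : Word) (t : Set Word) : ℕ := RHS (subtreeAt u t)

/-- The set of internal vertices of `t` (those having a child in `t`). -/
def internals (t : Set Word) : Set Word :=
  {u | u ∈ t ∧ (u ++ [false] ∈ t ∨ u ++ [true] ∈ t)}

/-- A Dyck path of length `2n`: `d 0 = 0`, steps of `±1` on `[0, 2n]`, `d (2n) = 0`;
by convention the path is extended by zero beyond time `2n`. -/
def IsDyck (n : ℕ) (d : ℕ → ℕ) : Prop :=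
  d 0 = 0 ∧ (∀ i, 2 * n ≤ i → d i = 0) ∧
  ∀ i < 2 * n, d (i + 1) = d i + 1 ∨ d i = d (i + 1) + 1

/-- The height ‖d‖ of a (zero-extended) Dyck path. -/
noncomputable def height (d : ℕ → ℕ) : ℕ := sSup (Set.range d)

/-- The `j`-th spinal subpath of `d`: `d_j^spn (i) = |d(ρ_j + 1 + i) − m| − 1` for
`i ∈ [0, ρ_{j+1} − ρ_j − 2]`, extended by zero (here `(a - b) + (b - a) = |a - b|` in ℕ). -/
def dspn (d : ℕ → ℕ) (m : ℕ) (ρ : ℕ → ℕ) (j : ℕ) : ℕ → ℕ := fun i =>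
  if i ≤ ρ (j + 1) - ρ j - 2
  then (d (ρ j + 1 + i) - m) + (m - d (ρ j + 1 + i)) - 1 else 0


namespace RefinedHortonStrahler

open BinaryTree PowerSeries Finset.HasAntidiagonal

/-! ### The algebraic identity -/

/-- Fibonacci polynomials evaluated at `z`: `q₀ = 0`, `q₁ = 1`, `q_{k+2} = q_{k+1} - z q_k`. -/
def fibPoly {R : Type*} [CommRing R] (z : R) : ℕ → R
  | 0 => 0
  | 1 => 1
  | k + 2 => fibPoly z (k + 1) - z * fibPoly z k

theorem fibPoly_add {R : Type*} [CommRing R] (z : R) (a b : ℕ) :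
    fibPoly z (a + b + 1) = fibPoly z (a + 1) * fibPoly z (b + 1) - z * (fibPoly z a * fibPoly z b)
      ∧ fibPoly z (a + b + 2) = fibPoly z (a + 2) * fibPoly z (b + 1)
        - z * (fibPoly z (a + 1) * fibPoly z b) := by
  induction b with
  | zero => simp [fibPoly]
  | succ b ih =>
    refine ⟨?_, ?_⟩
    · have := ih.2
      simp only [fibPoly] at this ⊢
      linear_combination this
    · have h1 := ih.1
      have h2 := ih.2
      have e : fibPoly z (a + (b + 1) + 2) = fibPoly z (a + b + 2) - z * fibPoly z (a + b + 1) := rfl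
      rw [e, h1, h2]
      simp only [fibPoly]
      ring

theorem map_fibPoly {R S F : Type*} [CommRing R] [CommRing S] [FunLike F R S] [RingHomClass F R S]
    (f : F) (z : R) (k : ℕ) : f (fibPoly z k) = fibPoly (f z) k := by
  induction k using Nat.twoStepInduction with
  | zero => simp [fibPoly]
  | one => simp [fibPoly]
  | more k h1 h2 => simp [fibPoly, h1, h2]

/-! ### Counting binary trees by their refined Horton–Strahler number -/

/-- The refined Horton–Strahler number of a binary tree, computed recursively. -/
def strahler : BinaryTree Unit → ℕ
  | nil => 0
  | node _ l r =>
    max (max (strahler l) (strahler r)) (min (2 * strahler l + 1) (2 * strahler r + 2))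

/-- The generating series of binary trees, weighted by `f`, according to the number of nodes. -/
noncomputable def treeSeries (f : BinaryTree Unit → ℤ) : ℤ⟦X⟧ :=
  PowerSeries.mk fun n => ∑ t ∈ treesOfNumNodesEq n, f t

theorem coeff_succ_treeSeries (f : BinaryTree Unit → ℤ) (n : ℕ) :
    coeff (n + 1) (treeSeries f) = ∑ p ∈ antidiagonal n,
      ∑ l ∈ treesOfNumNodesEq p.1, ∑ r ∈ treesOfNumNodesEq p.2, f (node () l r) := by
  rw [treeSeries, coeff_mk, treesOfNumNodesEq_succ, Finset.sum_biUnion]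
  · simp only [Finset.sum_map, Finset.sum_product]
    rfl
  · intro p _ p' _ hne
    rw [Function.onFun, Finset.disjoint_left]
    intro t ht ht'
    simp only [Finset.mem_map, Finset.mem_product, Prod.exists,
      mem_treesOfNumNodesEq] at ht ht'
    obtain ⟨l, r, ⟨h1, h2⟩, rfl⟩ := ht
    obtain ⟨l', r', ⟨h1', h2'⟩, h⟩ := ht'
    obtain ⟨-, rfl, rfl⟩ := node.inj h
    exact hne (Prod.ext (h1.symm.trans h1') (h2.symm.trans h2'))

theorem coeff_treeSeries_mul (f g : BinaryTree Unit → ℤ) (n : ℕ) :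
    coeff n (treeSeries f * treeSeries g) = ∑ p ∈ antidiagonal n,
      ∑ l ∈ treesOfNumNodesEq p.1, ∑ r ∈ treesOfNumNodesEq p.2, f l * g r := by
  simp [coeff_mul, treeSeries, Finset.sum_mul_sum]

/-- The indicator function of the trees with refined Horton–Strahler number smaller than `k`. -/
def strahlerLT (k : ℕ) (t : BinaryTree Unit) : ℤ := if strahler t < k then 1 else 0

theorem strahlerLT_node (k : ℕ) (l r : BinaryTree Unit) :
    strahlerLT (k + 1) (node () l r) =
      strahlerLT (k + 1) l * strahlerLT (k / 2) r
      + strahlerLT ((k + 1) / 2) l * strahlerLT (k + 1) r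
      - strahlerLT ((k + 1) / 2) l * strahlerLT (k / 2) r := by
  simp only [strahlerLT, strahler]
  by_cases h1 : strahler l < k + 1 <;> by_cases h2 : strahler r < k + 1 <;>
    by_cases h3 : strahler l < (k + 1) / 2 <;>
    by_cases h4 : strahler r < k / 2 <;> simp only [h1, h2, h3, h4, if_true, if_false] <;>
    split_ifs <;> omega

theorem treeSeries_strahlerLT_succ (k : ℕ) :
    treeSeries (strahlerLT (k + 1)) = 1 + X *
      (treeSeries (strahlerLT (k + 1)) * treeSeries (strahlerLT (k / 2))
      + treeSeries (strahlerLT ((k + 1) / 2)) * treeSeries (strahlerLT (k + 1))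
      - treeSeries (strahlerLT ((k + 1) / 2)) * treeSeries (strahlerLT (k / 2))) := by
  ext n
  cases n with
  | zero =>
    have h : strahlerLT (k + 1) nil = 1 := by simp [strahlerLT, strahler]
    simp only [treeSeries, coeff_mk, treesOfNumNodesEq_zero, Finset.sum_singleton, h]
    simp
  | succ n =>
    rw [coeff_succ_treeSeries, map_add, coeff_succ_X_mul, map_sub, map_add]
    simp only [coeff_treeSeries_mul, strahlerLT_node, Finset.sum_add_distrib,
      Finset.sum_sub_distrib]
    simp [coeff_one]

theorem treeSeries_strahlerLT_mul (k : ℕ) :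
    treeSeries (strahlerLT k) * fibPoly X (k + 1) = fibPoly X k := by
  induction k using Nat.strong_induction_on with
  | _ k ih =>
    cases k with
    | zero =>
      have : treeSeries (strahlerLT 0) = 0 := by ext; simp [treeSeries, strahlerLT]
      simp [this, fibPoly]
    | succ k =>
      have hF := treeSeries_strahlerLT_succ k
      have hA := ih ((k + 1) / 2) (by omega)
      have hB := ih (k / 2) (by omega)
      have hk : (k + 1) / 2 + k / 2 = k := by omega
      obtain ⟨h1, h2⟩ := fibPoly_add (X : ℤ⟦X⟧) ((k + 1) / 2) (k / 2)
      rw [hk] at h1 h2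
      rw [h1, h2]
      generalize treeSeries (strahlerLT (k + 1)) = F at *
      generalize treeSeries (strahlerLT ((k + 1) / 2)) = A at *
      generalize treeSeries (strahlerLT (k / 2)) = B at *
      generalize (k + 1) / 2 = a at *
      generalize k / 2 = b at *
      simp only [fibPoly]
      rw [← hA, ← hB]
      generalize fibPoly (X : ℤ⟦X⟧) (a + 1) = u
      generalize fibPoly (X : ℤ⟦X⟧) (b + 1) = v
      linear_combination u * v * hF

/-! ### Counting bounded Dyck paths -/

/-- The number of `±1`-walks of length `m` from `i` to `0` that stay in `[0, k)`. -/
def walkCount (k : ℕ) : ℕ → ℕ → ℕ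
  | 0, i => if i = 0 ∧ 0 < k then 1 else 0
  | m + 1, 0 => if 0 < k then walkCount k m 1 else 0
  | m + 1, i + 1 => if i + 1 < k then walkCount k m (i + 2) + walkCount k m i else 0

theorem walkCount_of_le {k i : ℕ} (h : k ≤ i) (m : ℕ) : walkCount k m i = 0 := by
  cases m <;> cases i <;> simp [walkCount] <;> omega

/-- The generating series of `walkCount` according to the length. -/
noncomputable def walkSeries (k i : ℕ) : ℤ⟦X⟧ := PowerSeries.mk fun m => (walkCount k m i : ℤ)

theorem walkSeries_of_le {k i : ℕ} (h : k ≤ i) : walkSeries k i = 0 := by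
  ext; simp [walkSeries, walkCount_of_le h]

theorem walkSeries_zero {k : ℕ} (hk : 0 < k) : walkSeries k 0 = 1 + X * walkSeries k 1 := by
  ext m
  cases m <;> simp [walkSeries, walkCount, hk, coeff_succ_X_mul, coeff_one]

theorem walkSeries_succ {k i : ℕ} (hi : i + 1 < k) :
    walkSeries k (i + 1) = X * (walkSeries k (i + 2) + walkSeries k i) := by
  ext m
  cases m <;> simp [walkSeries, walkCount, hi, coeff_succ_X_mul]

theorem X_pow_dvd_walkSeries_sub (k m : ℕ) : ∀ i ≤ k, (X : ℤ⟦X⟧) ^ m ∣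
    walkSeries k i * fibPoly (X ^ 2) (k + 1) - X ^ i * fibPoly (X ^ 2) (k - i) := by
  induction m with
  | zero => simp
  | succ m ih =>
    intro i hi
    obtain rfl | hlt := hi.eq_or_lt
    · simp [walkSeries_of_le le_rfl, fibPoly]
    obtain ⟨j, rfl⟩ := Nat.exists_eq_add_of_lt hlt
    cases i with
    | zero =>
      rw [walkSeries_zero (by omega)]
      obtain ⟨c, hc⟩ := ih 1 (by omega)
      refine ⟨c, ?_⟩
      have e : 0 + j + 1 - 0 = j + 1 := by omega
      have e' : 0 + j + 1 - 1 = j := by omega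
      have e'' : 0 + j + 1 + 1 = j + 2 := by omega
      rw [e', e''] at hc
      rw [e, e'']
      simp only [fibPoly] at hc ⊢
      linear_combination X * hc
    | succ i =>
      rw [walkSeries_succ hlt]
      obtain ⟨c, hc⟩ := ih i (by omega)
      obtain ⟨d, hd⟩ := ih (i + 2) (by omega)
      refine ⟨c + d, ?_⟩
      have e : i + 1 + j + 1 - (i + 1) = j + 1 := by omega
      have e' : i + 1 + j + 1 - i = j + 2 := by omega
      have e'' : i + 1 + j + 1 - (i + 2) = j := by omega
      rw [e'] at hc
      rw [e''] at hd
      rw [e]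
      simp only [fibPoly] at hc hd ⊢
      linear_combination X * hc + X * hd

theorem walkSeries_mul (k : ℕ) :
    walkSeries k 0 * fibPoly (X ^ 2) (k + 1) = fibPoly (X ^ 2) k := by
  rw [← sub_eq_zero]
  ext m
  have h := X_pow_dvd_walkSeries_sub k (m + 1) 0 (Nat.zero_le k)
  rw [X_pow_dvd_iff] at h
  simpa using h m (Nat.lt_succ_self m)

theorem fibPoly_X_sq_ne_zero (k : ℕ) : fibPoly (X ^ 2 : ℤ⟦X⟧) (k + 1) ≠ 0 := by
  have h : constantCoeff (fibPoly (X ^ 2 : ℤ⟦X⟧) (k + 1)) = 1 := by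
    induction k with
    | zero => simp [fibPoly]
    | succ k ih => simp [fibPoly, ih]
  intro h0
  simp [h0] at h

theorem card_strahler_lt (k n : ℕ) :
    ((treesOfNumNodesEq n).filter fun t => strahler t < k).card = walkCount k (2 * n) 0 := by
  have h : expand 2 two_ne_zero (treeSeries (strahlerLT k)) = walkSeries k 0 := by
    apply mul_right_cancel₀ (fibPoly_X_sq_ne_zero k)
    rw [walkSeries_mul]
    have := congrArg (expand 2 two_ne_zero) (treeSeries_strahlerLT_mul k)
    rwa [map_mul, map_fibPoly, map_fibPoly, expand_X] at this
  have h' := congrArg (coeff (2 * n)) h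
  rw [coeff_expand_mul] at h'
  simp only [treeSeries, walkSeries, coeff_mk, strahlerLT, Finset.sum_boole] at h'
  exact_mod_cast h'

/-- The `±1`-walks of length `m` from `i` to `0` that stay in `[0, k)`, extended by zero. -/
def boundedWalks (k m i : ℕ) : Set (ℕ → ℕ) :=
  {d | d 0 = i ∧ (∀ j, m ≤ j → d j = 0) ∧
    (∀ j < m, d (j + 1) = d j + 1 ∨ d j = d (j + 1) + 1) ∧ ∀ j, d j < k}

theorem boundedWalks_of_le {k i : ℕ} (h : k ≤ i) (m : ℕ) : boundedWalks k m i = ∅ := by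
  ext d
  simp only [boundedWalks, Set.mem_ofPred_eq, Set.mem_empty_iff_false, iff_false]
  rintro ⟨h0, -, -, hk⟩
  have := hk 0
  omega

/-- The sequence `d` with `i` prepended. -/
def prepend (i : ℕ) (d : ℕ → ℕ) : ℕ → ℕ
  | 0 => i
  | j + 1 => d j

theorem prepend_injective (i : ℕ) : Function.Injective (prepend i) := by
  intro d d' h
  funext j
  exact congrFun h (j + 1)

theorem prepend_mem_boundedWalks {k m i : ℕ} (hi : i < k) {d : ℕ → ℕ} :
    prepend i d ∈ boundedWalks k (m + 1) i ↔
      d ∈ boundedWalks k m (i + 1) ∨ ∃ i', i = i' + 1 ∧ d ∈ boundedWalks k m i' := by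
  constructor
  · rintro ⟨-, hz, hs, hk⟩
    have hd : ∀ i', d 0 = i' → d ∈ boundedWalks k m i' := fun i' h =>
      ⟨h, fun j hj => hz (j + 1) (by omega), fun j hj => hs (j + 1) (by omega),
        fun j => hk (j + 1)⟩
    rcases hs 0 (by omega) with h | h
    · exact Or.inl (hd _ h)
    · exact Or.inr ⟨d 0, h, hd _ rfl⟩
  · intro h
    have hd : (d 0 = i + 1 ∨ i = d 0 + 1) ∧ d ∈ boundedWalks k m (d 0) := by
      rcases h with h | ⟨i', rfl, h⟩
      · have h0 := h.1
        exact ⟨Or.inl h0, h0 ▸ h⟩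
      · have h0 := h.1
        exact ⟨Or.inr (h0 ▸ rfl), h0.symm ▸ h⟩
    obtain ⟨h0, -, hz, hs, hk⟩ := hd
    refine ⟨rfl, fun j hj => ?_, fun j hj => ?_, fun j => ?_⟩
    · obtain ⟨j, rfl⟩ := Nat.exists_eq_add_of_le' (Nat.one_le_of_lt hj)
      exact hz j (by omega)
    · cases j with
      | zero => exact h0
      | succ j => exact hs j (by omega)
    · cases j with
      | zero => exact hi
      | succ j => exact hk j

theorem eq_prepend {k m i : ℕ} {d : ℕ → ℕ} (h : d ∈ boundedWalks k m i) :
    prepend i (fun j => d (j + 1)) = d := by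
  funext j
  cases j with
  | zero => exact h.1.symm
  | succ j => rfl

theorem boundedWalks_succ_zero {k : ℕ} (hk : 0 < k) (m : ℕ) :
    boundedWalks k (m + 1) 0 = prepend 0 '' boundedWalks k m 1 := by
  ext d
  constructor
  · intro h
    refine ⟨_, ?_, eq_prepend h⟩
    rw [← eq_prepend h, prepend_mem_boundedWalks hk] at h
    simpa using h
  · rintro ⟨d, h, rfl⟩
    exact (prepend_mem_boundedWalks hk).2 (Or.inl h)

theorem boundedWalks_succ_succ {k i : ℕ} (hi : i + 1 < k) (m : ℕ) :
    boundedWalks k (m + 1) (i + 1) =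
      prepend (i + 1) '' (boundedWalks k m (i + 2) ∪ boundedWalks k m i) := by
  ext d
  constructor
  · intro h
    refine ⟨_, ?_, eq_prepend h⟩
    rw [← eq_prepend h, prepend_mem_boundedWalks hi] at h
    simpa using h
  · rintro ⟨d, h, rfl⟩
    exact (prepend_mem_boundedWalks hi).2 (h.imp_right fun h => ⟨i, rfl, h⟩)

theorem encard_boundedWalks (k m : ℕ) : ∀ i, (boundedWalks k m i).encard = walkCount k m i := by
  induction m with
  | zero =>
    intro i
    by_cases h : i = 0 ∧ 0 < k
    · obtain ⟨rfl, h⟩ := h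
      have : boundedWalks k 0 0 = {0} := by
        ext d
        simp only [boundedWalks, Set.mem_ofPred_eq, Set.mem_singleton_iff]
        constructor
        · rintro ⟨-, h, -⟩
          funext j
          exact h j (Nat.zero_le j)
        · rintro rfl
          simp [h]
      simp [this, walkCount, h]
    · have : boundedWalks k 0 i = ∅ := by
        ext d
        simp only [boundedWalks, Set.mem_ofPred_eq, Set.mem_empty_iff_false, iff_false]
        rintro ⟨h0, hz, -, hk⟩
        have := hz 0 le_rfl
        have := hk 0
        omega
      simp [this, walkCount, h]
  | succ m ih =>
    intro i
    obtain hi | hi := le_or_gt k i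
    · simp [boundedWalks_of_le hi, walkCount_of_le hi]
    cases i with
    | zero =>
      rw [boundedWalks_succ_zero hi, (prepend_injective 0).encard_image, ih]
      simp [walkCount, hi]
    | succ i =>
      rw [boundedWalks_succ_succ hi, (prepend_injective _).encard_image, Set.encard_union_eq, ih, ih]
      · simp [walkCount, hi]
      · rw [Set.disjoint_left]
        intro d h h'
        have := h.1.symm.trans h'.1
        omega

theorem ncard_boundedWalks (k m i : ℕ) : (boundedWalks k m i).ncard = walkCount k m i := by
  simp [Set.ncard, encard_boundedWalks]

theorem finite_boundedWalks (k m i : ℕ) : (boundedWalks k m i).Finite :=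
  Set.finite_of_encard_eq_coe (encard_boundedWalks k m i)

theorem height_lt_iff {n : ℕ} {d : ℕ → ℕ} (hd : IsDyck n d) (k : ℕ) :
    _root_.height d < k ↔ ∀ i, d i < k := by
  have hfin : (Set.range d).Finite := by
    refine ((Set.finite_Iio (2 * n)).image d |>.insert 0).subset ?_
    rintro _ ⟨i, rfl⟩
    obtain h | h := le_or_gt (2 * n) i
    · exact Or.inl (hd.2.1 i h)
    · exact Or.inr ⟨i, h, rfl⟩
  constructor
  · intro h i
    exact (le_csSup hfin.bddAbove ⟨i, rfl⟩).trans_lt h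
  · intro h
    obtain ⟨i, hi⟩ := Nat.sSup_mem (Set.range_nonempty d) hfin.bddAbove
    exact (hi.symm.trans_lt (h i) :)

theorem card_dyck_height_add (n h : ℕ) :
    Nat.card {d : ℕ → ℕ // IsDyck n d ∧ _root_.height d = h} + walkCount h (2 * n) 0 =
      walkCount (h + 1) (2 * n) 0 := by
  have hmem (k : ℕ) (d : ℕ → ℕ) : d ∈ boundedWalks k (2 * n) 0 ↔
      IsDyck n d ∧ _root_.height d < k := by
    constructor
    · rintro ⟨h0, hz, hs, hk⟩
      have hd : IsDyck n d := ⟨h0, hz, hs⟩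
      exact ⟨hd, (height_lt_iff hd k).2 hk⟩
    · rintro ⟨hd, hk⟩
      exact ⟨hd.1, hd.2.1, hd.2.2, (height_lt_iff hd k).1 hk⟩
  have hsub : boundedWalks h (2 * n) 0 ⊆ boundedWalks (h + 1) (2 * n) 0 := by
    intro d
    rw [hmem, hmem]
    exact fun hd => ⟨hd.1, hd.2.trans (Nat.lt_succ_self h)⟩
  have hdiff : {d : ℕ → ℕ | IsDyck n d ∧ _root_.height d = h} =
      boundedWalks (h + 1) (2 * n) 0 \ boundedWalks h (2 * n) 0 := by
    ext d
    rw [Set.mem_sdiff, hmem, hmem, Set.mem_ofPred_eq]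
    constructor
    · rintro ⟨hd, rfl⟩
      exact ⟨⟨hd, Nat.lt_succ_self _⟩, fun h => h.2.false⟩
    · rintro ⟨⟨hd, h1⟩, h2⟩
      exact ⟨hd, le_antisymm (Nat.le_of_lt_succ h1) (not_lt.1 fun h3 => h2 ⟨hd, h3⟩)⟩
  rw [← Set.coe_ofPred, Nat.card_coe_set_eq, hdiff, ← ncard_boundedWalks, ← ncard_boundedWalks]
  exact Set.ncard_sdiff_add_ncard_of_subset hsub (finite_boundedWalks _ _ _)

/-! ### Binary trees as sets of words -/

/-- The set of vertices of a binary tree. -/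
def vertices : BinaryTree Unit → Set Word
  | nil => {[]}
  | node _ l r => {[]} ∪ graft false (vertices l) ∪ graft true (vertices r)

theorem nil_mem_vertices (t : BinaryTree Unit) : [] ∈ vertices t := by
  cases t <;> simp [vertices]

theorem cons_mem_vertices_node {x : Unit} {b : Bool} {w : Word} {l r : BinaryTree Unit} :
    b :: w ∈ vertices (node x l r) ↔ w ∈ vertices (bif b then r else l) := by
  cases b <;> simp [vertices, graft]

theorem cons_notMem_vertices_nil {b : Bool} {w : Word} : b :: w ∉ vertices nil := by
  simp [vertices]

theorem finite_vertices (t : BinaryTree Unit) : (vertices t).Finite := by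
  induction t with
  | nil => exact Set.finite_singleton _
  | node _ l r hl hr => exact ((Set.finite_singleton _).union (hl.image _)).union (hr.image _)

theorem mem_vertices_of_prefix_of_mem (t : BinaryTree Unit) :
    ∀ u ∈ vertices t, ∀ v : Word, v <+: u → v ∈ vertices t := by
  induction t with
  | nil =>
    rintro u hu v hv
    obtain rfl : u = [] := hu
    rw [List.prefix_nil.1 hv]
    exact nil_mem_vertices _
  | node _ l r hl hr =>
    rintro u hu v hv
    cases v with
    | nil => exact nil_mem_vertices _
    | cons b v =>
      obtain ⟨w, rfl⟩ := hv
      rw [List.cons_append, cons_mem_vertices_node] at hu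
      rw [cons_mem_vertices_node]
      cases b
      · exact hl _ hu _ ⟨w, rfl⟩
      · exact hr _ hu _ ⟨w, rfl⟩

theorem isFull_vertices (t : BinaryTree Unit) : IsFull (vertices t) := by
  induction t with
  | nil =>
    rintro u hu
    obtain rfl : u = [] := hu
    simp [cons_notMem_vertices_nil]
  | node _ l r hl hr =>
    rintro u hu
    cases u with
    | nil => simp [cons_mem_vertices_node, nil_mem_vertices]
    | cons b u =>
      rw [cons_mem_vertices_node] at hu
      rw [List.cons_append, List.cons_append, cons_mem_vertices_node, cons_mem_vertices_node]
      cases b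
      · exact hl _ hu
      · exact hr _ hu

theorem isFullBinaryTree_vertices (t : BinaryTree Unit) : IsFullBinaryTree (vertices t) :=
  ⟨⟨finite_vertices t, nil_mem_vertices t, mem_vertices_of_prefix_of_mem t⟩, isFull_vertices t⟩

theorem vertices_injective : Function.Injective vertices := by
  intro t
  induction t with
  | nil =>
    intro t h
    cases t with
    | nil => rfl
    | node _ l r =>
      have : [false] ∈ vertices (node () l r) := by
        simp [cons_mem_vertices_node, nil_mem_vertices]
      rw [← h] at this
      exact absurd this cons_notMem_vertices_nil
  | node _ l r hl hr =>
    intro t h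
    cases t with
    | nil =>
      have : [false] ∈ vertices (node () l r) := by
        simp [cons_mem_vertices_node, nil_mem_vertices]
      rw [h] at this
      exact absurd this cons_notMem_vertices_nil
    | node _ l' r' =>
      have key (b : Bool) : vertices (bif b then r else l) = vertices (bif b then r' else l') := by
        ext w
        rw [← cons_mem_vertices_node, ← cons_mem_vertices_node, h]
      rw [hl (a₂ := l') (key false), hr (a₂ := r') (key true)]

theorem isFullBinaryTree_subtreeAt {t : Set Word} (ht : IsFullBinaryTree t) {u : Word}
    (hu : u ∈ t) : IsFullBinaryTree (subtreeAt u t) := by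
  obtain ⟨⟨hfin, -, hpre⟩, hfull⟩ := ht
  refine ⟨⟨hfin.preimage (List.append_right_injective u).injOn, ?_, ?_⟩, ?_⟩
  · simpa [subtreeAt] using hu
  · intro v hv w hw
    exact hpre _ hv _ ((List.prefix_append_right_inj u).2 hw)
  · intro v hv
    have := hfull _ hv
    simpa only [subtreeAt, Set.mem_ofPred_eq, List.append_assoc] using this

theorem exists_vertices_eq_of_length_le (N : ℕ) : ∀ t : Set Word, IsFullBinaryTree t →
    (∀ u ∈ t, u.length ≤ N) → ∃ T, vertices T = t := by
  induction N with
  | zero =>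
    intro t ht hN
    refine ⟨nil, Set.Subset.antisymm ?_ ?_⟩
    · rintro _ rfl
      exact ht.1.2.1
    · intro u hu
      exact List.length_eq_zero_iff.1 (Nat.le_zero.1 (hN u hu))
  | succ N ih =>
    intro t ht hN
    have hnil := ht.1.2.1
    have hiff : [false] ∈ t ↔ [true] ∈ t := ht.2 [] hnil
    have hcons {b : Bool} {u : Word} (h : b :: u ∈ t) : [b] ∈ t := ht.1.2.2 _ h _ ⟨u, rfl⟩
    by_cases hf : [false] ∈ t
    · have hsub (b : Bool) (hb : [b] ∈ t) : ∃ T, vertices T = subtreeAt [b] t :=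
        ih _ (isFullBinaryTree_subtreeAt ht hb) fun u hu => by simpa using hN _ hu
      obtain ⟨l, hl⟩ := hsub false hf
      obtain ⟨r, hr⟩ := hsub true (hiff.1 hf)
      refine ⟨node () l r, ?_⟩
      ext w
      cases w with
      | nil => simp [nil_mem_vertices, hnil]
      | cons b w => cases b <;> simp [cons_mem_vertices_node, hl, hr, subtreeAt]
    · refine ⟨nil, ?_⟩
      ext w
      cases w with
      | nil => simp [nil_mem_vertices, hnil]
      | cons b w =>
        refine iff_of_false cons_notMem_vertices_nil fun h => ?_
        have := hcons h
        cases b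
        · exact hf this
        · exact hf (hiff.2 this)

theorem exists_vertices_eq {t : Set Word} (ht : IsFullBinaryTree t) : ∃ T, vertices T = t := by
  obtain ⟨N, hN⟩ := (ht.1.1.image List.length).bddAbove
  exact exists_vertices_eq_of_length_le N t ht fun u hu => hN ⟨u, hu, rfl⟩

theorem internals_vertices_node (l r : BinaryTree Unit) :
    internals (vertices (node () l r)) =
      {[]} ∪ (graft false (internals (vertices l)) ∪ graft true (internals (vertices r))) := by
  ext w
  cases w with
  | nil => simp [internals, nil_mem_vertices, cons_mem_vertices_node]
  | cons b w => cases b <;> simp [internals, graft, cons_mem_vertices_node]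

theorem ncard_internals_vertices (t : BinaryTree Unit) :
    (internals (vertices t)).ncard = t.numNodes := by
  suffices h : (internals (vertices t)).encard = t.numNodes by simp [Set.ncard, h]
  induction t with
  | nil =>
    have : internals (vertices nil) = ∅ := by ext w; simp [internals, vertices]
    simp [this]
  | node _ l r hl hr =>
    rw [internals_vertices_node, Set.encard_union_eq, Set.encard_union_eq, graft, graft,
      (List.cons_injective).encard_image, (List.cons_injective).encard_image, hl, hr]
    · simp [add_comm]
    · simp [graft, Set.disjoint_left]
    · simp [graft]

/-! ### Embeddings of binary trees -/

theorem lcp_nil_left (v : Word) : lcp [] v = [] := rfl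

theorem lcp_nil_right (u : Word) : lcp u [] = [] := by cases u <;> rfl

theorem lcp_cons_self (b : Bool) (u v : Word) : lcp (b :: u) (b :: v) = b :: lcp u v := by
  simp [lcp]

theorem lcp_append_left (p u v : Word) : lcp (p ++ u) (p ++ v) = p ++ lcp u v := by
  induction p with
  | nil => rfl
  | cons c p ih => rw [List.cons_append, List.cons_append, lcp_cons_self, ih, List.cons_append]

theorem lcp_prefix_left (u v : Word) : lcp u v <+: u := by
  induction u generalizing v with
  | nil => exact List.nil_prefix
  | cons a u ih =>
    cases v with
    | nil => exact List.nil_prefix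
    | cons b v =>
      by_cases h : a = b
      · subst h
        rw [lcp_cons_self]
        exact (List.prefix_cons_inj a).2 (ih v)
      · simp [lcp, h]

theorem lcp_comm (u v : Word) : lcp u v = lcp v u := by
  induction u generalizing v with
  | nil => rw [lcp_nil_left, lcp_nil_right]
  | cons a u ih =>
    cases v with
    | nil => rfl
    | cons b v =>
      by_cases h : a = b
      · subst h
        rw [lcp_cons_self, lcp_cons_self, ih]
      · simp [lcp, h, Ne.symm h]

theorem lcp_prefix_right (u v : Word) : lcp u v <+: v :=
  lcp_comm v u ▸ lcp_prefix_left v u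

theorem lcp_mem_vertices {t : BinaryTree Unit} {u : Word} (hu : u ∈ vertices t) (v : Word) :
    lcp u v ∈ vertices t :=
  mem_vertices_of_prefix_of_mem t u hu _ (lcp_prefix_left u v)

theorem lcp_cons_of_ne {a b : Bool} (h : a ≠ b) (u v : Word) : lcp (a :: u) (b :: v) = [] := by
  simp [lcp, h]

theorem wlex_cons_self {b : Bool} {u v : Word} : wlex (b :: u) (b :: v) ↔ wlex u v := by
  simp [wlex]

theorem wlex_append_left {p u v : Word} : wlex (p ++ u) (p ++ v) ↔ wlex u v := by
  induction p with
  | nil => rfl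
  | cons c p ih => rw [List.cons_append, List.cons_append, wlex_cons_self, ih]

theorem wlex_false_true (u v : Word) : wlex (false :: u) (true :: v) := List.Lex.rel (by decide)

theorem not_wlex_true_false (u v : Word) : ¬ wlex (true :: u) (false :: v) := by
  intro h
  cases h with
  | rel h => exact absurd h (by decide)

theorem wlex_nil_cons (b : Bool) (u : Word) : wlex [] (b :: u) := List.Lex.nil

theorem not_wlex_nil (u : Word) : ¬ wlex u [] := by
  intro h; cases h

theorem embeds_nil (t : BinaryTree Unit) : Embeds (vertices nil) (vertices t) := by
  refine ⟨fun _ => [], fun u _ => nil_mem_vertices t, ?_, ?_, fun u _ v _ => rfl⟩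
  · rintro u rfl v rfl h
    exact absurd rfl h
  · rintro u rfl v rfl h
    exact absurd h (not_wlex_nil _)

theorem not_embeds_node_nil (a b : BinaryTree Unit) :
    ¬ Embeds (vertices (node () a b)) (vertices nil) := by
  rintro ⟨φ, h1, h2, -⟩
  have hf : [false] ∈ vertices (node () a b) := by simp [cons_mem_vertices_node, nil_mem_vertices]
  have h0 := nil_mem_vertices (node () a b)
  exact h2 _ hf _ h0 (by simp) (((h1 _ hf) : φ [false] = []).trans (h1 _ h0 : φ [] = []).symm)

theorem embeds_node_of_child {a l r : BinaryTree Unit} {b : Bool}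
    (h : Embeds (vertices a) (vertices (bif b then r else l))) :
    Embeds (vertices a) (vertices (node () l r)) := by
  obtain ⟨φ, h1, h2, h3, h4⟩ := h
  refine ⟨fun u => b :: φ u, fun u hu => ?_, fun u hu v hv huv h => ?_, fun u hu v hv huv => ?_,
    fun u hu v hv => ?_⟩
  · exact cons_mem_vertices_node.2 (h1 u hu)
  · exact h2 u hu v hv huv (List.cons_injective h)
  · exact wlex_cons_self.2 (h3 u hu v hv huv)
  · change b :: φ (lcp u v) = _
    rw [lcp_cons_self, h4 u hu v hv]

theorem embeds_node_node {a b l r : BinaryTree Unit} (hl : Embeds (vertices a) (vertices l))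
    (hr : Embeds (vertices b) (vertices r)) :
    Embeds (vertices (node () a b)) (vertices (node () l r)) := by
  obtain ⟨φ, h1, h2, h3, h4⟩ := hl
  obtain ⟨ψ, g1, g2, g3, g4⟩ := hr
  let χ : Word → Word
    | [] => []
    | false :: u => false :: φ u
    | true :: u => true :: ψ u
  refine ⟨χ, ?_, ?_, ?_, ?_⟩
  · rintro (_ | ⟨_ | _, u⟩) hu
    · exact nil_mem_vertices _
    · exact cons_mem_vertices_node.2 (h1 u (cons_mem_vertices_node.1 hu))
    · exact cons_mem_vertices_node.2 (g1 u (cons_mem_vertices_node.1 hu))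
  · rintro (_ | ⟨_ | _, u⟩) hu (_ | ⟨_ | _, v⟩) hv huv <;>
      try simp only [cons_mem_vertices_node, cond_true, cond_false] at hu hv
    · exact absurd rfl huv
    · exact (List.cons_ne_nil _ _).symm
    · exact (List.cons_ne_nil _ _).symm
    · exact List.cons_ne_nil _ _
    · exact fun h => h2 u hu v hv (by rintro rfl; exact huv rfl) (List.cons_injective h)
    · simp [χ]
    · exact List.cons_ne_nil _ _
    · simp [χ]
    · exact fun h => g2 u hu v hv (by rintro rfl; exact huv rfl) (List.cons_injective h)
  · rintro (_ | ⟨_ | _, u⟩) hu (_ | ⟨_ | _, v⟩) hv huv <;>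
      try simp only [cons_mem_vertices_node, cond_true, cond_false] at hu hv
    · exact absurd huv (not_wlex_nil _)
    · exact wlex_nil_cons _ _
    · exact wlex_nil_cons _ _
    · exact absurd huv (not_wlex_nil _)
    · exact wlex_cons_self.2 (h3 u hu v hv (wlex_cons_self.1 huv))
    · exact wlex_false_true _ _
    · exact absurd huv (not_wlex_nil _)
    · exact absurd huv (not_wlex_true_false _ _)
    · exact wlex_cons_self.2 (g3 u hu v hv (wlex_cons_self.1 huv))
  · rintro (_ | ⟨_ | _, u⟩) hu (_ | ⟨_ | _, v⟩) hv <;>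
      try simp only [cons_mem_vertices_node, cond_true, cond_false] at hu hv
    all_goals try rfl
    · simp only [lcp_cons_self, χ, h4 u hu v hv]
    · simp only [lcp_cons_self, χ, g4 u hu v hv]

/-- An embedding all of whose values, on a subtree, start with the same letter induces an
embedding of this subtree into the corresponding child. -/
theorem embeds_child_of_isEmbedding {t : Set Word} {l r : BinaryTree Unit} {φ : Word → Word}
    (hφ : IsEmbedding t (vertices (node () l r)) φ) {s : Set Word} (p : Word)
    (hs : ∀ u ∈ s, p ++ u ∈ t) {b : Bool} (hb : ∀ u ∈ s, ∃ w, φ (p ++ u) = b :: w)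
    (hlcp : ∀ u ∈ s, ∀ v, lcp u v ∈ s) :
    Embeds s (vertices (bif b then r else l)) := by
  obtain ⟨h1, h2, h3, h4⟩ := hφ
  have hb' (u : Word) (hu : u ∈ s) : φ (p ++ u) = b :: (φ (p ++ u)).tail := by
    obtain ⟨w, hw⟩ := hb u hu
    rw [hw, List.tail_cons]
  refine ⟨fun u => (φ (p ++ u)).tail, fun u hu => ?_, fun u hu v hv huv h => ?_,
    fun u hu v hv huv => ?_, fun u hu v hv => ?_⟩
  · rw [← cons_mem_vertices_node, ← hb' u hu]
    exact h1 _ (hs u hu)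
  · refine h2 _ (hs u hu) _ (hs v hv) (by simpa using huv) ?_
    rw [hb' u hu, hb' v hv]
    exact congrArg (b :: ·) h
  · rw [← wlex_cons_self (b := b), ← hb' u hu, ← hb' v hv]
    exact h3 _ (hs u hu) _ (hs v hv) (wlex_append_left.2 huv)
  · apply List.cons_injective (a := b)
    rw [← lcp_cons_self, ← hb' u hu, ← hb' v hv, ← hb' _ (hlcp u hu v), ← lcp_append_left]
    exact h4 _ (hs u hu) _ (hs v hv)

theorem embeds_node_node_iff {a b l r : BinaryTree Unit} :
    Embeds (vertices (node () a b)) (vertices (node () l r)) ↔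
      Embeds (vertices (node () a b)) (vertices l) ∨
      Embeds (vertices (node () a b)) (vertices r) ∨
      Embeds (vertices a) (vertices l) ∧ Embeds (vertices b) (vertices r) := by
  constructor
  · rintro ⟨φ, hφ⟩
    have hnil := nil_mem_vertices (node () a b)
    obtain ⟨-, h2, h3, h4⟩ := id hφ
    rcases h0 : φ [] with _ | ⟨c, p⟩
    · right; right
      have hcons (e : Bool) (u : Word) (hu : u ∈ vertices (bif e then b else a)) :
          ∃ c w, φ (e :: u) = c :: w := by
        have := h2 _ (cons_mem_vertices_node.2 hu) _ hnil (by simp)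
        rw [h0] at this
        exact List.exists_cons_of_ne_nil this
      have hsplit (u v : Word) (hu : u ∈ vertices a) (hv : v ∈ vertices b) :
          (∃ w, φ (false :: u) = false :: w) ∧ ∃ w, φ (true :: v) = true :: w := by
        obtain ⟨c, x, hc⟩ := hcons false u hu
        obtain ⟨d, y, hd⟩ := hcons true v hv
        have hu' : false :: u ∈ vertices (node () a b) := cons_mem_vertices_node.2 hu
        have hv' : true :: v ∈ vertices (node () a b) := cons_mem_vertices_node.2 hv
        have hlcp := h4 _ hu' _ hv'
        rw [lcp_cons_of_ne (by decide), h0, hc, hd] at hlcp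
        have hlex := h3 _ hu' _ hv' (wlex_false_true u v)
        rw [hc, hd] at hlex
        cases c <;> cases d
        · simp [lcp_cons_self] at hlcp
        · exact ⟨⟨x, hc⟩, y, hd⟩
        · exact absurd hlex (not_wlex_true_false _ _)
        · simp [lcp_cons_self] at hlcp
      exact ⟨embeds_child_of_isEmbedding hφ [false] (b := false)
          (fun u hu => cons_mem_vertices_node.2 hu)
          (fun u hu => (hsplit u [] hu (nil_mem_vertices b)).1) fun u hu => lcp_mem_vertices hu,
        embeds_child_of_isEmbedding hφ [true] (b := true) (fun u hu => cons_mem_vertices_node.2 hu)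
          (fun u hu => (hsplit [] u (nil_mem_vertices a) hu).2) fun u hu => lcp_mem_vertices hu⟩
    · have h := embeds_child_of_isEmbedding hφ (s := vertices (node () a b)) [] (b := c)
        (fun u hu => hu) (fun u hu => ?_) fun u hu => lcp_mem_vertices hu
      · cases c
        · exact Or.inl h
        · exact Or.inr (Or.inl h)
      · have hlcp := h4 _ hnil u hu
        rw [lcp_nil_left, h0] at hlcp
        have hpre := lcp_prefix_right (c :: p) (φ u)
        rw [← hlcp] at hpre
        obtain ⟨w, hw⟩ := hpre
        exact ⟨p ++ w, hw.symm⟩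
  · rintro (h | h | ⟨hl, hr⟩)
    · exact embeds_node_of_child (b := false) h
    · exact embeds_node_of_child (b := true) h
    · exact embeds_node_node hl hr

/-- The tree whose set of vertices is `tau k`. -/
def tauTree : ℕ → BinaryTree Unit
  | 0 => nil
  | k + 1 => node () (tauTree ((k + 1) / 2)) (tauTree (k / 2))

theorem vertices_tauTree (k : ℕ) : vertices (tauTree k) = tau k := by
  induction k using Nat.strong_induction_on with
  | _ k ih =>
    match k with
    | 0 => rw [tauTree, tau, vertices]
    | 1 =>
      rw [tauTree, tau, vertices]
      ext w
      simp [tauTree, vertices, graft]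
      tauto
    | k + 2 =>
      rw [tauTree, tau, vertices, ih _ (by omega), ih _ (by omega)]

theorem embeds_tau_vertices_iff (t : BinaryTree Unit) :
    ∀ k, Embeds (tau k) (vertices t) ↔ k ≤ strahler t := by
  simp only [← vertices_tauTree]
  induction t with
  | nil =>
    rintro (_ | k)
    · simpa [tauTree] using embeds_nil nil
    · simpa [tauTree, strahler] using not_embeds_node_nil _ _
  | node _ l r hl hr =>
    rintro (_ | k)
    · simpa [tauTree] using embeds_nil _
    · have hl' := hl (k + 1)
      have hr' := hr (k + 1)
      rw [tauTree] at hl' hr' ⊢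
      rw [embeds_node_node_iff, hl', hr', hl, hr, strahler]
      omega

theorem RHS_vertices (t : BinaryTree Unit) : RHS (vertices t) = strahler t := by
  simp only [RHS, embeds_tau_vertices_iff]
  exact csSup_Iic

theorem card_tree_RHS_add (n h : ℕ) :
    Nat.card {t : Set Word // IsFullBinaryTree t ∧ (internals t).ncard = n ∧ RHS t = h} +
      ((treesOfNumNodesEq n).filter fun t => strahler t < h).card =
      ((treesOfNumNodesEq n).filter fun t => strahler t < h + 1).card := by
  have himage : {t : Set Word | IsFullBinaryTree t ∧ (internals t).ncard = n ∧ RHS t = h} =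
      vertices '' ↑((treesOfNumNodesEq n).filter fun t => strahler t = h) := by
    ext t
    simp only [Set.mem_ofPred_eq, Set.mem_image, Finset.mem_coe, Finset.mem_filter,
      mem_treesOfNumNodesEq]
    constructor
    · rintro ⟨ht, hn, hh⟩
      obtain ⟨T, rfl⟩ := exists_vertices_eq ht
      exact ⟨T, ⟨(ncard_internals_vertices T).symm.trans hn, (RHS_vertices T).symm.trans hh⟩, rfl⟩
    · rintro ⟨T, ⟨hn, hh⟩, rfl⟩
      exact ⟨isFullBinaryTree_vertices T, (ncard_internals_vertices T).trans hn,
        (RHS_vertices T).trans hh⟩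
  rw [← Set.coe_ofPred, Nat.card_coe_set_eq, himage,
    Set.ncard_image_of_injective _ vertices_injective, Set.ncard_coe_finset,
    ← Finset.card_union_of_disjoint, ← Finset.filter_or]
  · congr 1
    ext t
    simp only [Finset.mem_filter, and_congr_right_iff]
    omega
  · rw [Finset.disjoint_filter]
    omega

end RefinedHortonStrahler

open RefinedHortonStrahler in
/-- For all `n, h ≥ 0`, the number of full binary trees with `n` internal vertices and refined
Horton–Strahler number `h` equals the number of Dyck paths of length `2n` with height `h`. -/
theorem refined_horton_strahler_count (n h : ℕ) :
    Nat.card {t : Set Word // IsFullBinaryTree t ∧ (internals t).ncard = n ∧ RHS t = h} =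
    Nat.card {d : ℕ → ℕ // IsDyck n d ∧ height d = h} := by
  have h1 := card_tree_RHS_add n h
  have h2 := card_dyck_height_add n h
  rw [card_strahler_lt, card_strahler_lt] at h1
  omega
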